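/- arXiv:1201.2754 — 8 statements merged into one kernel-verified Lean document; each statement's English description precedes it below -/
import Mathlib

section
/- Let A be a unital C*-algebra and U, V ∈ A unitaries satisfying VU = e^{2πiθ} UV, where θ, μ ∈ ℝ satisfy μ > 0 and |μ cos(πθ)| > 1. Set q = e^{2πiθ}, z = e^{iπθ}/(2i cos(πθ)), R = μ·1 + zU + conj(z)U* (which is positive and invertible), W' = √R · V and Λ' = U, where √R denotes the continuous-functional-calculus square root. Then the pair (W', Λ') satisfies all five relations: W'Λ' = qΛ'W'; W'*Λ' = conj(q)Λ'W'*; W'*Λ'* = qΛ'*W'* and W'Λ'* = conj(q)Λ'*W'; Λ'*Λ' = Λ'Λ'* = 1; W'W'* = zΛ' + conj(z)Λ'* + μ·1; and W'*W' = −conj(z)Λ' − zΛ'* + μ·1. -/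
open Real Complex

theorem norm_le_one_of_mem_unitary {A : Type*} [CStarAlgebra A] {U : A} (hU : U ∈ unitary A) :
    ‖U‖ ≤ 1 := by
  nontriviality A
  exact (CStarRing.norm_of_mem_unitary hU).le

theorem isStrictlyPositive_smul_one_add_unitary {A : Type*} [CStarAlgebra A] [PartialOrder A]
    [StarOrderedRing A] {U : A} (hU : U ∈ unitary A) {μ : ℝ} {z : ℂ} (hz : 2 * ‖z‖ < μ) :
    IsStrictlyPositive ((μ : ℂ) • (1 : A) + z • U + (starRingEnd ℂ z) • star U) := by
  set T : A := z • U + (starRingEnd ℂ z) • star U with hT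
  have hTsa : IsSelfAdjoint T := by
    rw [IsSelfAdjoint, hT, star_add, star_smul, star_smul, star_star]
    simp [add_comm]
  have hTnorm : ‖T‖ < μ := by
    have hle : ‖T‖ ≤ ‖z‖ * ‖U‖ + ‖z‖ * ‖U‖ := by
      refine (norm_add_le _ _).trans_eq ?_
      simp [norm_smul]
    have := mul_le_of_le_one_right (norm_nonneg z) (norm_le_one_of_mem_unitary hU)
    linarith
  have hpos : IsStrictlyPositive (algebraMap ℝ A (μ - ‖T‖)) :=
    isStrictlyPositive_algebraMap (sub_pos.2 hTnorm)
  have hle : algebraMap ℝ A (μ - ‖T‖) ≤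
      (μ : ℂ) • (1 : A) + z • U + (starRingEnd ℂ z) • star U := by
    have := add_le_add_right hTsa.neg_algebraMap_norm_le_self (algebraMap ℝ A μ)
    rw [add_assoc, ← hT, map_sub, sub_eq_add_neg, Complex.coe_smul,
      ← Algebra.algebraMap_eq_smul_one]
    exact this
  rw [IsStrictlyPositive.iff_of_unital]
  exact ⟨hpos.nonneg.trans hle, CStarAlgebra.isUnit_of_le _ hle hpos⟩

/-- If `W` commutes with a unitary `U` up to a phase `q`, then it commutes with `star U` up to the
conjugate phase. -/
theorem mul_star_eq_conj_smul {A : Type*} [Ring A] [StarRing A] [Algebra ℂ A]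
    {U W : A} (hU : U ∈ unitary A) {q : ℂ} (hq : starRingEnd ℂ q * q = 1)
    (h : W * U = q • (U * W)) : W * star U = (starRingEnd ℂ q) • (star U * W) := by
  have : star U * W = q • (W * star U) := by
    calc star U * W = star U * (W * U) * star U := by
          simp [mul_assoc, Unitary.mul_star_self_of_mem hU]
      _ = q • (star U * U * W * star U) := by rw [h]; simp [mul_assoc]
      _ = q • (W * star U) := by simp [Unitary.star_mul_self_of_mem hU]
  rw [this, smul_smul, hq, one_smul]

/-- The adjoint of an element commuting with `U` up to a phase `q` commutes with `star U` up to
the same phase. -/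
theorem star_mul_star_eq_smul {A : Type*} [Ring A] [StarRing A] [Algebra ℂ A] [StarModule ℂ A]
    {U W : A} {q : ℂ} (hq : starRingEnd ℂ q * q = 1)
    (h : W * U = q • (U * W)) : star W * star U = q • (star U * star W) := by
  have := congrArg star h
  rw [star_mul, star_smul, star_mul] at this
  rw [this, smul_smul, mul_comm, ← starRingEnd_apply, hq, one_smul]

theorem conj_exp_ofReal_mul_I (x : ℝ) :
    starRingEnd ℂ (Complex.exp (x * Complex.I)) = (Complex.exp (x * Complex.I))⁻¹ := by
  rw [← Complex.exp_conj, ← Complex.exp_neg]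
  simp

/-- If `U, V` are unitaries in a unital C*-algebra satisfying
`VU = e^{2πiθ} UV`, with `μ > 0` and `|μ cos(πθ)| > 1`, then `W' = √R · V` and `Λ' = U`
(where `R = μ·1 + zU + conj(z)U*`) satisfy the five defining relations of the deformed
torus algebra `A⁰_{μ,θ}`. -/
theorem stmt1 {A : Type*} [CStarAlgebra A] [PartialOrder A] [StarOrderedRing A]
    (U V : A) (hU : U ∈ unitary A) (hV : V ∈ unitary A)
    (θ μ : ℝ) (hμ : 0 < μ) (hμθ : 1 < |μ * Real.cos (Real.pi * θ)|)
    (hcomm : V * U = Complex.exp (2 * Real.pi * θ * Complex.I) • (U * V)) :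
    let q : ℂ := Complex.exp (2 * Real.pi * θ * Complex.I)
    let z : ℂ := Complex.exp (Real.pi * θ * Complex.I) /
      (2 * Complex.I * (Real.cos (Real.pi * θ) : ℂ))
    let R : A := (μ : ℂ) • 1 + z • U + (starRingEnd ℂ z) • star U
    let W' : A := CFC.sqrt R * V
    let Λ' : A := U
    (0 ≤ R ∧ IsUnit R) ∧
    W' * Λ' = q • (Λ' * W') ∧
    star W' * Λ' = (starRingEnd ℂ q) • (Λ' * star W') ∧
    star W' * star Λ' = q • (star Λ' * star W') ∧
    W' * star Λ' = (starRingEnd ℂ q) • (star Λ' * W') ∧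
    star Λ' * Λ' = 1 ∧ Λ' * star Λ' = 1 ∧
    W' * star W' = z • Λ' + (starRingEnd ℂ z) • star Λ' + (μ : ℂ) • 1 ∧
    star W' * W' = -((starRingEnd ℂ z) • Λ') - z • star Λ' + (μ : ℂ) • 1 := by
  intro q z R W' Λ'
  have hcos : Real.cos (Real.pi * θ) ≠ 0 := by
    intro h
    norm_num [h] at hμθ
  have hq : starRingEnd ℂ q * q = 1 := by
    have := conj_exp_ofReal_mul_I (2 * Real.pi * θ)
    push_cast at this
    simp only [q, this]
    exact inv_mul_cancel₀ (Complex.exp_ne_zero _)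
  have hzq : z * starRingEnd ℂ q = -starRingEnd ℂ z := by
    have hcos' : (Real.cos (Real.pi * θ) : ℂ) ≠ 0 := Complex.ofReal_ne_zero.2 hcos
    have h₂ := conj_exp_ofReal_mul_I (Real.pi * θ)
    push_cast at h₂
    have h₃ : Complex.exp (2 * Real.pi * θ * Complex.I) =
        Complex.exp (Real.pi * θ * Complex.I) * Complex.exp (Real.pi * θ * Complex.I) := by
      rw [← Complex.exp_add]
      ring_nf
    have h₄ := Complex.exp_ne_zero (Real.pi * θ * Complex.I)
    simp only [q, z, map_div₀, map_mul, Complex.conj_ofReal, Complex.conj_I, h₂, h₃,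
      map_ofNat]
    field_simp
  have hznorm : 2 * ‖z‖ < μ := by
    have hexp : ‖Complex.exp (Real.pi * θ * Complex.I)‖ = 1 := by
      exact_mod_cast Complex.norm_exp_ofReal_mul_I (Real.pi * θ)
    have habs := abs_pos.2 hcos
    have hz : 2 * ‖z‖ = 1 / |Real.cos (Real.pi * θ)| := by
      simp only [z, norm_div, norm_mul, hexp, Complex.norm_I, Complex.norm_real, Real.norm_eq_abs,
        Complex.norm_ofNat]
      field_simp
    rw [hz, div_lt_iff₀ habs]
    rwa [abs_mul, abs_of_pos hμ] at hμθ
  have hR : IsStrictlyPositive R := isStrictlyPositive_smul_one_add_unitary hU hznorm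
  have hUU : star U * U = 1 := Unitary.star_mul_self_of_mem hU
  have hUU' : U * star U = 1 := Unitary.mul_star_self_of_mem hU
  have hVV : star V * V = 1 := Unitary.star_mul_self_of_mem hV
  have hVV' : V * star V = 1 := Unitary.mul_star_self_of_mem hV
  have hRU : Commute R U :=
    (((Commute.one_left U).smul_left _).add_left ((Commute.refl U).smul_left _)).add_left
      ((show Commute (star U) U from hUU.trans hUU'.symm).smul_left _)
  have hSU : CFC.sqrt R * U = U * CFC.sqrt R := by
    rw [CFC.sqrt_eq_cfc]
    exact hRU.cfc_nnreal _
  have hS : star (CFC.sqrt R) = CFC.sqrt R := (CFC.sqrt_nonneg R).isSelfAdjoint.star_eq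
  have hSS : CFC.sqrt R * CFC.sqrt R = R := CFC.sqrt_mul_sqrt_self R hR.nonneg
  have hWU : W' * U = q • (U * W') := by
    simp only [W']
    rw [mul_assoc (CFC.sqrt R), hcomm, mul_smul_comm, ← mul_assoc, hSU, mul_assoc U]
  have hWU' : W' * star U = (starRingEnd ℂ q) • (star U * W') := mul_star_eq_conj_smul hU hq hWU
  have hqc : starRingEnd ℂ (starRingEnd ℂ q) * starRingEnd ℂ q = 1 := by
    rw [← map_mul, hq, map_one]
  have hVU : star V * U * V = starRingEnd ℂ q • U := by
    have h := star_mul_star_eq_smul hqc (mul_star_eq_conj_smul hU hq hcomm)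
    rw [star_star] at h
    rw [h, smul_mul_assoc, mul_assoc, hVV, mul_one]
  have hVU' : star V * star U * V = q • star U := by
    rw [star_mul_star_eq_smul hq hcomm, smul_mul_assoc, mul_assoc, hVV, mul_one]
  have hzq' : starRingEnd ℂ z * q = -z := by
    simpa using congrArg (starRingEnd ℂ) hzq
  refine ⟨⟨hR.nonneg, hR.isUnit⟩, hWU, ?_, star_mul_star_eq_smul hq hWU, hWU', hUU, hUU', ?_, ?_⟩
  · simpa using star_mul_star_eq_smul hqc hWU'
  · calc W' * star W' = CFC.sqrt R * (V * star V) * CFC.sqrt R := by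
          simp only [W', star_mul, hS, mul_assoc]
      _ = R := by rw [hVV', mul_one, hSS]
      _ = _ := by simp only [R, Λ']; abel
  · calc star W' * W' = star V * (CFC.sqrt R * CFC.sqrt R) * V := by
          simp only [W', star_mul, hS, mul_assoc]
      _ = (μ : ℂ) • (star V * V) + z • (star V * U * V) +
          starRingEnd ℂ z • (star V * star U * V) := by
        rw [hSS]
        simp only [R, mul_add, add_mul, mul_smul_comm, smul_mul_assoc, mul_one]
      _ = _ := by
        rw [hVV, hVU, hVU', smul_smul, smul_smul, hzq, hzq', neg_smul, neg_smul]
        simp only [Λ']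
        abel
end

section
/- Let A be a unital C*-algebra and U, V ∈ A unitaries satisfying VU = e^{2πiθ} UV, with θ, μ ∈ ℝ, μ > 0 and |μ cos(πθ)| > 1. Set q = e^{2πiθ}, z = e^{iπθ}/(2i cos(πθ)), R = μ·1 + zU + conj(z)U* and R' = μ·1 + z·conj(q)·U + conj(z)·q·U*. Then both R and R' are positive and invertible, V*RV = R', and consequently (√R)·V = V·(√R'), where √ denotes the continuous-functional-calculus square root. -/
open Real Complex

open scoped ComplexConjugate in
theorem smul_one_add_smul_unitary_nonneg_and_isUnit {A : Type*} [CStarAlgebra A] [PartialOrder A]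
    [StarOrderedRing A] {U : A} (hU : U ∈ unitary A) {w : ℂ} {μ : ℝ} (hw : 2 * ‖w‖ < μ) :
    0 ≤ (μ : ℂ) • (1 : A) + w • U + conj w • star U ∧
      IsUnit ((μ : ℂ) • (1 : A) + w • U + conj w • star U) := by
  rcases subsingleton_or_nontrivial A with hA | hA
  · exact ⟨(Subsingleton.elim _ _).le, isUnit_of_subsingleton _⟩
  set x : A := w • U + conj w • star U with hx
  have hxs : IsSelfAdjoint x := by
    simp [IsSelfAdjoint, hx, star_smul, add_comm]
  have hxn : ‖x‖ ≤ 2 * ‖w‖ := by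
    calc ‖x‖ ≤ ‖w • U‖ + ‖conj w • star U‖ := norm_add_le _ _
      _ = 2 * ‖w‖ := by
        rw [norm_smul, norm_smul, norm_star, CStarRing.norm_of_mem_unitary hU, RCLike.norm_conj]
        ring
  have hle : algebraMap ℝ A (μ - 2 * ‖w‖) ≤ (μ : ℂ) • (1 : A) + w • U + conj w • star U := by
    have hμ : (μ : ℂ) • (1 : A) = algebraMap ℝ A μ := by
      rw [Algebra.algebraMap_eq_smul_one, Complex.coe_smul]
    calc algebraMap ℝ A (μ - 2 * ‖w‖) ≤ algebraMap ℝ A (μ - ‖x‖) :=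
          algebraMap_mono A (by linarith)
      _ = algebraMap ℝ A μ + -algebraMap ℝ A ‖x‖ := by rw [map_sub, sub_eq_add_neg]
      _ ≤ algebraMap ℝ A μ + x := by gcongr; exact hxs.neg_algebraMap_norm_le_self
      _ = _ := by rw [hμ, hx, add_assoc]
  have hpos : IsStrictlyPositive (algebraMap ℝ A (μ - 2 * ‖w‖)) :=
    ⟨algebraMap_nonneg A (by linarith), (IsUnit.mk0 _ (by linarith)).map (algebraMap ℝ A)⟩
  exact ⟨hpos.nonneg.trans hle, CStarAlgebra.isUnit_of_le _ hle⟩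

theorem star_mul_mul_eq_conj_smul {A : Type*} [CStarAlgebra A] {U V : A} (hV : V ∈ unitary A)
    {q : ℂ} (hq : starRingEnd ℂ q * q = 1) (hcomm : V * U = q • (U * V)) :
    star V * U * V = starRingEnd ℂ q • U := by
  have hUV : U * V = starRingEnd ℂ q • (V * U) := by rw [hcomm, smul_smul, hq, one_smul]
  rw [mul_assoc, hUV, mul_smul_comm, ← mul_assoc, Unitary.star_mul_self_of_mem hV, one_mul]

theorem CFC.sqrt_mul_eq_mul_sqrt_conjugate {A : Type*} [CStarAlgebra A] [PartialOrder A]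
    [StarOrderedRing A] {R V : A} (hR : 0 ≤ R) (hV : V ∈ unitary A) :
    CFC.sqrt R * V = V * CFC.sqrt (star V * R * V) := by
  have hVV : V * star V = 1 := Unitary.mul_star_self_of_mem hV
  have h : CFC.sqrt (star V * R * V) = star V * CFC.sqrt R * V := by
    refine CFC.sqrt_unique ?_ (star_left_conjugate_nonneg (CFC.sqrt_nonneg R) V)
    calc star V * CFC.sqrt R * V * (star V * CFC.sqrt R * V)
        = star V * CFC.sqrt R * (V * star V) * CFC.sqrt R * V := by noncomm_ring
      _ = star V * (CFC.sqrt R * CFC.sqrt R) * V := by rw [hVV]; noncomm_ring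
      _ = star V * R * V := by rw [CFC.sqrt_mul_sqrt_self R]
  rw [h, ← mul_assoc, ← mul_assoc, hVV, one_mul]

/-- With `U, V` unitaries satisfying `VU = e^{2πiθ}UV`, `μ > 0`,
`|μ cos(πθ)| > 1`, `R = μ·1 + zU + conj(z)U*` and `R' = μ·1 + z q̄ U + conj(z) q U*`:
both `R` and `R'` are positive and invertible, `V*RV = R'`, and `√R · V = V · √R'`. -/
theorem stmt2 {A : Type*} [CStarAlgebra A] [PartialOrder A] [StarOrderedRing A]
    (U V : A) (hU : U ∈ unitary A) (hV : V ∈ unitary A)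
    (θ μ : ℝ) (hμ : 0 < μ) (hμθ : 1 < |μ * Real.cos (Real.pi * θ)|)
    (hcomm : V * U = Complex.exp (2 * Real.pi * θ * Complex.I) • (U * V)) :
    let q : ℂ := Complex.exp (2 * Real.pi * θ * Complex.I)
    let z : ℂ := Complex.exp (Real.pi * θ * Complex.I) /
      (2 * Complex.I * (Real.cos (Real.pi * θ) : ℂ))
    let R : A := (μ : ℂ) • 1 + z • U + (starRingEnd ℂ z) • star U
    let R' : A := (μ : ℂ) • 1 + (z * starRingEnd ℂ q) • U + (starRingEnd ℂ z * q) • star U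
    (0 ≤ R ∧ IsUnit R) ∧ (0 ≤ R' ∧ IsUnit R') ∧
    star V * R * V = R' ∧
    CFC.sqrt R * V = V * CFC.sqrt R' := by
  intro q z R R'
  have hq : starRingEnd ℂ q * q = 1 := by
    rw [Complex.conj_mul', show ‖q‖ = 1 from ?_]
    · simp
    · have := Complex.norm_exp_ofReal_mul_I (2 * Real.pi * θ)
      push_cast at this
      exact this
  have hz : 2 * ‖z‖ < μ := by
    have hnum : ‖Complex.exp (Real.pi * θ * Complex.I)‖ = 1 := by
      have := Complex.norm_exp_ofReal_mul_I (Real.pi * θ)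
      push_cast at this
      exact this
    rw [abs_mul, abs_of_pos hμ] at hμθ
    have hcos : 0 < |Real.cos (Real.pi * θ)| := by
      by_contra! h
      nlinarith
    have hnorm : ‖z‖ = 1 / (2 * |Real.cos (Real.pi * θ)|) := by
      simp only [z, norm_div, hnum, norm_mul, Complex.norm_I, Complex.norm_real, Real.norm_eq_abs]
      norm_num
    rw [hnorm, show 2 * (1 / (2 * |Real.cos (Real.pi * θ)|)) = 1 / |Real.cos (Real.pi * θ)| by
      field_simp, div_lt_iff₀ hcos]
    exact hμθ
  have hR : 0 ≤ R ∧ IsUnit R := smul_one_add_smul_unitary_nonneg_and_isUnit hU hz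
  have hconjU : star V * U * V = starRingEnd ℂ q • U := star_mul_mul_eq_conj_smul hV hq hcomm
  have hconjU' : star V * star U * V = q • star U := by
    simpa [mul_assoc] using congrArg star hconjU
  have hconj : star V * R * V = R' := by
    simp only [R, R', mul_add, add_mul, mul_smul_comm, smul_mul_assoc, hconjU, hconjU', smul_smul,
      mul_one, Unitary.star_mul_self_of_mem hV]
  have hVunit : IsUnit V := (Unitary.toUnits ⟨V, hV⟩).isUnit
  refine ⟨hR, ?_, hconj, ?_⟩
  · rw [← hconj]
    exact ⟨star_left_conjugate_nonneg hR.1 V, (hVunit.star.mul hR.2).mul hVunit⟩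
  · rw [← hconj]
    exact CFC.sqrt_mul_eq_mul_sqrt_conjugate hR.1 hV
end

section
/- Let A be a unital C*-algebra, let θ, μ ∈ ℝ with μ > 0 and |μ cos(πθ)| > 1, set q = e^{2πiθ} and z = e^{iπθ}/(2i cos(πθ)). Suppose W, Λ ∈ A with Λ unitary satisfy: WΛ = qΛW, W*Λ = conj(q)ΛW*, WW* = zΛ + conj(z)Λ* + μ·1, and W*W = −conj(z)Λ − zΛ* + μ·1. Set R' = μ·1 + zΛ + conj(z)Λ* (which is positive and invertible) and V = (R')^{-1/2} · W. Then V is unitary and VΛ = qΛV. -/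
open Real Complex

/-- If `U` is unitary and `2‖z‖ < m`, then `m + zU + conj(z)U*` is strictly positive. -/
theorem isStrictlyPositive_smul_one_add_smul_unitary {A : Type*} [CStarAlgebra A]
    [PartialOrder A] [StarOrderedRing A] {U : A} (hU : U ∈ unitary A) {m : ℝ} {z : ℂ}
    (h : 2 * ‖z‖ < m) :
    IsStrictlyPositive ((m : ℂ) • (1 : A) + z • U + (starRingEnd ℂ z) • star U) := by
  set b : A := z • U + (starRingEnd ℂ z) • star U with hb
  have hb_self : IsSelfAdjoint b := by
    simp [hb, IsSelfAdjoint, star_add, star_smul, add_comm]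
  have hU_norm : ‖U‖ ≤ 1 := by
    nontriviality A
    exact (CStarRing.norm_of_mem_unitary hU).le
  have hb_norm : ‖b‖ ≤ 2 * ‖z‖ := by
    calc ‖b‖ ≤ ‖z • U‖ + ‖(starRingEnd ℂ z) • star U‖ := norm_add_le _ _
      _ = 2 * (‖z‖ * ‖U‖) := by
        rw [norm_smul, norm_smul, norm_star, RCLike.norm_conj]; ring
      _ ≤ 2 * ‖z‖ := by nlinarith [norm_nonneg z]
  have hpos : IsStrictlyPositive (algebraMap ℝ A (m - ‖b‖)) :=
    isStrictlyPositive_algebraMap (by linarith)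
  refine hpos.of_le ?_
  have hle := add_le_add_right hb_self.neg_algebraMap_norm_le_self (algebraMap ℝ A m)
  have hm : (m : ℂ) • (1 : A) = algebraMap ℝ A m := by
    rw [Algebra.algebraMap_eq_smul_one]; exact Complex.coe_smul m (1 : A)
  rwa [← sub_eq_add_neg, ← map_sub, ← hm, hb, ← add_assoc] at hle

/-- If both `W*W` and `WW*` are invertible, then the polar part `(WW*)^{-1/2} W` is unitary. -/
theorem rpow_neg_one_half_mul_self_mem_unitary {A : Type*} [CStarAlgebra A] [PartialOrder A]
    [StarOrderedRing A] {W : A} (hl : IsUnit (star W * W))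
    (hr : IsStrictlyPositive (W * star W)) :
    (W * star W) ^ (-(1 / 2 : ℝ)) * W ∈ unitary A := by
  have hW : IsUnit W := by
    obtain ⟨c, hc⟩ := hl.exists_left_inv
    obtain ⟨d, hd⟩ := hr.isUnit.exists_right_inv
    exact isUnit_iff_exists_and_exists.mpr
      ⟨⟨star W * d, by rw [← mul_assoc, hd]⟩, ⟨c * star W, by rw [mul_assoc, hc]⟩⟩
  have hV := (hr.rpow (W * star W) (-(1 / 2 : ℝ))).isUnit.mul hW
  have hself : star ((W * star W) ^ (-(1 / 2 : ℝ))) = (W * star W) ^ (-(1 / 2 : ℝ)) :=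
    (IsSelfAdjoint.of_nonneg CFC.rpow_nonneg).star_eq
  have hVV : ((W * star W) ^ (-(1 / 2 : ℝ)) * W) *
      star ((W * star W) ^ (-(1 / 2 : ℝ)) * W) = 1 := by
    rw [star_mul, hself]
    simpa only [mul_assoc] using CFC.conjugate_rpow_neg_one_half (W * star W) hr
  exact Unitary.mem_iff.mpr ⟨hV.isRegular.left.mul_eq_one_symm hVV, hVV⟩

/-- If `W, Λ` in a unital C*-algebra satisfy the deformed torus
relations (with `Λ` unitary), then `V = (R')^{-1/2} W`, where
`R' = μ·1 + zΛ + conj(z)Λ*`, is unitary and satisfies `VΛ = qΛV`. -/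
theorem stmt3 {A : Type*} [CStarAlgebra A] [PartialOrder A] [StarOrderedRing A]
    (θ μ : ℝ) (hμ : 0 < μ) (hμθ : 1 < |μ * Real.cos (Real.pi * θ)|)
    (W Λ : A) (hΛ : Λ ∈ unitary A)
    (h1 : W * Λ = Complex.exp (2 * Real.pi * θ * Complex.I) • (Λ * W))
    (h2 : star W * Λ = (starRingEnd ℂ (Complex.exp (2 * Real.pi * θ * Complex.I))) •
      (Λ * star W))
    (h4 : W * star W =
      (Complex.exp (Real.pi * θ * Complex.I) /
        (2 * Complex.I * (Real.cos (Real.pi * θ) : ℂ))) • Λ +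
      (starRingEnd ℂ (Complex.exp (Real.pi * θ * Complex.I) /
        (2 * Complex.I * (Real.cos (Real.pi * θ) : ℂ)))) • star Λ + (μ : ℂ) • 1)
    (h5 : star W * W =
      -((starRingEnd ℂ (Complex.exp (Real.pi * θ * Complex.I) /
        (2 * Complex.I * (Real.cos (Real.pi * θ) : ℂ)))) • Λ) -
      (Complex.exp (Real.pi * θ * Complex.I) /
        (2 * Complex.I * (Real.cos (Real.pi * θ) : ℂ))) • star Λ + (μ : ℂ) • 1) :
    let z : ℂ := Complex.exp (Real.pi * θ * Complex.I) /
      (2 * Complex.I * (Real.cos (Real.pi * θ) : ℂ))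
    let R' : A := (μ : ℂ) • 1 + z • Λ + (starRingEnd ℂ z) • star Λ
    let V : A := CFC.rpow R' (-(1/2 : ℝ)) * W
    (0 ≤ R' ∧ IsUnit R') ∧ V ∈ unitary A ∧
    V * Λ = Complex.exp (2 * Real.pi * θ * Complex.I) • (Λ * V) := by
  intro z R' V
  have hcos : 0 < |Real.cos (Real.pi * θ)| := by
    refine abs_pos.mpr fun h => ?_
    norm_num [h] at hμθ
  have hz : 2 * ‖z‖ < μ := by
    have hexp : ‖Complex.exp (Real.pi * θ * Complex.I)‖ = 1 := by
      exact_mod_cast Complex.norm_exp_ofReal_mul_I (Real.pi * θ)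
    have hnorm : ‖z‖ = 1 / (2 * |Real.cos (Real.pi * θ)|) := by
      simp only [z, norm_div, norm_mul, hexp, Complex.norm_I, Complex.norm_real,
        Real.norm_eq_abs, Complex.norm_ofNat, mul_one]
    rw [abs_mul, abs_of_pos hμ] at hμθ
    rw [hnorm, show 2 * (1 / (2 * |Real.cos (Real.pi * θ)|)) =
      1 / |Real.cos (Real.pi * θ)| by field_simp, div_lt_iff₀ hcos]
    exact hμθ
  have hR : IsStrictlyPositive R' := isStrictlyPositive_smul_one_add_smul_unitary hΛ hz
  have hWW : W * star W = R' := by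
    rw [h4]; simp only [R', z]; abel
  have hl : IsUnit (star W * W) := by
    have hS := isStrictlyPositive_smul_one_add_smul_unitary hΛ (m := μ)
      (z := -(starRingEnd ℂ z)) (by simpa using hz)
    convert hS.isUnit using 1
    rw [h5, map_neg, Complex.conj_conj, neg_smul, neg_smul]
    simp only [z]; abel
  have hV : V ∈ unitary A := by
    have := rpow_neg_one_half_mul_self_mem_unitary hl (hWW ▸ hR)
    rwa [hWW] at this
  have hcomm : Commute R' Λ := by
    have hstar : Commute (star Λ) Λ :=
      (Unitary.star_mul_self_of_mem hΛ).trans (Unitary.mul_star_self_of_mem hΛ).symm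
    exact (((Commute.one_left Λ).smul_left _).add_left ((Commute.refl Λ).smul_left _)).add_left
      (hstar.smul_left _)
  have hpow : Commute (CFC.rpow R' (-(1/2 : ℝ))) Λ := hcomm.cfc_nnreal _
  refine ⟨⟨hR.nonneg, hR.isUnit⟩, hV, ?_⟩
  simp only [V]
  rw [mul_assoc, h1, mul_smul_comm, ← mul_assoc, hpow.eq, mul_assoc Λ]
end

section
/- Let θ, μ ∈ ℝ with μ > 0 and |μ cos(πθ)| > 1, q = e^{2πiθ}, z = e^{iπθ}/(2i cos(πθ)). Let A⁰_{μ,θ} be the quotient of the free unital associative ℂ-algebra on four generators W, W°, Λ, Λ° by the two-sided ideal generated by the eight elements: WΛ − qΛW, WΛ° − conj(q)Λ°W, W°Λ° − qΛ°W°, W°Λ − conj(q)ΛW°, ΛΛ° − 1, Λ°Λ − 1, WW° − (zΛ + conj(z)Λ° + μ·1), and W°W − (−conj(z)Λ − zΛ° + μ·1). Then the family consisting of T_m = e^{iπθ m₁m₂} Λ^{m₁} W^{m₂} for (m₁, m₂) ∈ ℤ × ℤ_{≥0} together with S_n = e^{-iπθ n₁n₂} Λ^{n₁} (W°)^{n₂}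 for (n₁, n₂) ∈ ℤ × ℤ_{≥1} is a basis of A⁰_{μ,θ} as a ℂ-vector space, where Λ^{-k} denotes (Λ°)^k for k > 0. -/
open Real Complex

noncomputable section

/-- The free unital associative ℂ-algebra on four generators `W, W°, Λ, Λ°`. -/
abbrev FreeFour := FreeAlgebra ℂ (Fin 4)

def Wg : FreeFour := FreeAlgebra.ι ℂ (0 : Fin 4)
def Wog : FreeFour := FreeAlgebra.ι ℂ (1 : Fin 4)
def Lg : FreeFour := FreeAlgebra.ι ℂ (2 : Fin 4)
def Log : FreeFour := FreeAlgebra.ι ℂ (3 : Fin 4)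

def qc (θ : ℝ) : ℂ := Complex.exp (2 * Real.pi * θ * Complex.I)
def zc (θ : ℝ) : ℂ :=
  Complex.exp (Real.pi * θ * Complex.I) / (2 * Complex.I * (Real.cos (Real.pi * θ) : ℂ))

/-- The eight defining relations of the deformed torus algebra `A⁰_{μ,θ}`. -/
inductive TorusRel (θ μ : ℝ) : FreeFour → FreeFour → Prop
  | rel1 : TorusRel θ μ (Wg * Lg) (qc θ • (Lg * Wg))
  | rel2 : TorusRel θ μ (Wg * Log) ((starRingEnd ℂ (qc θ)) • (Log * Wg))
  | rel3 : TorusRel θ μ (Wog * Log) (qc θ • (Log * Wog))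
  | rel4 : TorusRel θ μ (Wog * Lg) ((starRingEnd ℂ (qc θ)) • (Lg * Wog))
  | rel5 : TorusRel θ μ (Lg * Log) 1
  | rel6 : TorusRel θ μ (Log * Lg) 1
  | rel7 : TorusRel θ μ (Wg * Wog)
      (zc θ • Lg + (starRingEnd ℂ (zc θ)) • Log + (μ : ℂ) • 1)
  | rel8 : TorusRel θ μ (Wog * Wg)
      (-((starRingEnd ℂ (zc θ)) • Lg) - zc θ • Log + (μ : ℂ) • 1)

/-- The deformed torus algebra `A⁰_{μ,θ}`: the quotient of the free algebra by the
two-sided ideal generated by the eight relations. -/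
abbrev DefTorus (θ μ : ℝ) := RingQuot (TorusRel θ μ)

def Wq (θ μ : ℝ) : DefTorus θ μ := RingQuot.mkAlgHom ℂ (TorusRel θ μ) Wg
def Woq (θ μ : ℝ) : DefTorus θ μ := RingQuot.mkAlgHom ℂ (TorusRel θ μ) Wog
def Lq (θ μ : ℝ) : DefTorus θ μ := RingQuot.mkAlgHom ℂ (TorusRel θ μ) Lg
def Loq (θ μ : ℝ) : DefTorus θ μ := RingQuot.mkAlgHom ℂ (TorusRel θ μ) Log

/-- `Λ^k` for `k ∈ ℤ`, where negative powers of `Λ` are interpreted as powers of `Λ°`. -/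
def lpow (θ μ : ℝ) (k : ℤ) : DefTorus θ μ :=
  if 0 ≤ k then (Lq θ μ) ^ k.toNat else (Loq θ μ) ^ (-k).toNat

/-- The family `T_m = e^{iπθ m₁m₂} Λ^{m₁} W^{m₂}`, `(m₁,m₂) ∈ ℤ × ℤ_{≥0}`
(indexed by `Sum.inl`), together with `S_n = e^{-iπθ n₁n₂} Λ^{n₁} (W°)^{n₂}`,
`(n₁,n₂) ∈ ℤ × ℤ_{≥1}` (indexed by `Sum.inr (n₁, n₂ - 1)`). -/
def torusFam (θ μ : ℝ) : (ℤ × ℕ) ⊕ (ℤ × ℕ) → DefTorus θ μ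
  | .inl m => Complex.exp (Real.pi * θ * ((m.1 * m.2 : ℤ) : ℂ) * Complex.I) •
      (lpow θ μ m.1 * (Wq θ μ) ^ m.2)
  | .inr n => Complex.exp (-(Real.pi * θ * ((n.1 * (n.2 + 1) : ℤ) : ℂ) * Complex.I)) •
      (lpow θ μ n.1 * (Woq θ μ) ^ (n.2 + 1))

/-- The space with basis `e(k, n)`, `k n : ℤ`, standing for `Λ^k W^n` if `0 ≤ n` and for
`Λ^k (W°)^{-n}` if `n ≤ 0`. -/
abbrev TorusModel := (ℤ × ℤ) →₀ ℂ

namespace TorusModel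

/-- The basis vector `e(k, n)`. -/
def e (k n : ℤ) : TorusModel := Finsupp.single (k, n) 1

/-- The operator shifting the first index by `d`. -/
def shift (d : ℤ) : Module.End ℂ TorusModel :=
  Finsupp.linearCombination ℂ fun p => e (p.1 + d) p.2

/-- The action of `W`. -/
def opW (q z w μ : ℂ) : Module.End ℂ TorusModel :=
  Finsupp.linearCombination ℂ fun p => q ^ p.1 •
    if 0 ≤ p.2 then e p.1 (p.2 + 1)
    else z • e (p.1 + 1) (p.2 + 1) + w • e (p.1 + -1) (p.2 + 1) + μ • e p.1 (p.2 + 1)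

/-- The action of `W°`. -/
def opWo (q z w μ : ℂ) : Module.End ℂ TorusModel :=
  Finsupp.linearCombination ℂ fun p => q ^ (-p.1) •
    if p.2 ≤ 0 then e p.1 (p.2 - 1)
    else -(w • e (p.1 + 1) (p.2 - 1)) - z • e (p.1 + -1) (p.2 - 1) + μ • e p.1 (p.2 - 1)

lemma shift_e (d k n : ℤ) : shift d (e k n) = e (k + d) n := by
  simp [shift, e]

lemma opW_e_of_nonneg (q z w μ : ℂ) (k : ℤ) {n : ℤ} (hn : 0 ≤ n) :
    opW q z w μ (e k n) = q ^ k • e k (n + 1) := by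
  simp [opW, e, hn]

lemma opW_e_of_neg (q z w μ : ℂ) (k : ℤ) {n : ℤ} (hn : n < 0) :
    opW q z w μ (e k n) = q ^ k •
      (z • e (k + 1) (n + 1) + w • e (k + -1) (n + 1) + μ • e k (n + 1)) := by
  simp [opW, e, not_le.2 hn]

lemma opWo_e_of_nonpos (q z w μ : ℂ) (k : ℤ) {n : ℤ} (hn : n ≤ 0) :
    opWo q z w μ (e k n) = q ^ (-k) • e k (n - 1) := by
  simp [opWo, e, hn]

lemma opWo_e_of_pos (q z w μ : ℂ) (k : ℤ) {n : ℤ} (hn : 0 < n) :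
    opWo q z w μ (e k n) = q ^ (-k) •
      (-(w • e (k + 1) (n - 1)) - z • e (k + -1) (n - 1) + μ • e k (n - 1)) := by
  simp [opWo, e, not_le.2 hn]

lemma end_ext {f g : Module.End ℂ TorusModel} (h : ∀ k n, f (e k n) = g (e k n)) : f = g :=
  Finsupp.lhom_ext' fun p => LinearMap.ext_ring (h p.1 p.2)

lemma shift_mul_shift (c d : ℤ) : shift c * shift d = shift (d + c) :=
  end_ext fun k n => by simp [shift_e, add_assoc]

lemma shift_zero : shift 0 = 1 :=
  end_ext fun k n => by simp [shift_e]

variable {q : ℂ} (z w μ : ℂ)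

lemma opW_mul_shift (hq : q ≠ 0) (d : ℤ) :
    opW q z w μ * shift d = q ^ d • (shift d * opW q z w μ) := by
  refine end_ext fun k n => ?_
  rcases le_or_gt 0 n with hn | hn
  · simp [shift_e, opW_e_of_nonneg _ _ _ _ _ hn, smul_smul, zpow_add₀ hq, mul_comm]
  · simp only [Module.End.mul_apply, LinearMap.smul_apply, shift_e, opW_e_of_neg _ _ _ _ _ hn,
      map_smul, map_add, zpow_add₀ hq, add_right_comm k]
    module

lemma opWo_mul_shift (hq : q ≠ 0) (d : ℤ) :
    opWo q z w μ * shift d = q ^ (-d) • (shift d * opWo q z w μ) := by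
  refine end_ext fun k n => ?_
  rcases le_or_gt n 0 with hn | hn
  · simp [shift_e, opWo_e_of_nonpos _ _ _ _ _ hn, smul_smul, zpow_add₀ hq]
  · simp only [Module.End.mul_apply, LinearMap.smul_apply, shift_e, opWo_e_of_pos _ _ _ _ _ hn,
      map_smul, map_add, map_sub, map_neg, zpow_add₀ hq, neg_add, add_right_comm k]
    module

variable {z w}

lemma opW_mul_opWo (hq : q ≠ 0) (hz : w * q = -z) :
    opW q z w μ * opWo q z w μ = z • shift 1 + w • shift (-1) + μ • 1 := by
  obtain rfl : z = -(w * q) := by rw [hz, neg_neg]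
  refine end_ext fun k n => ?_
  rcases le_or_gt n 0 with hn | hn
  · simp only [Module.End.mul_apply, LinearMap.smul_apply, LinearMap.add_apply, shift_e,
      opWo_e_of_nonpos _ _ _ _ _ hn, map_smul,
      opW_e_of_neg _ _ _ _ _ (show n - 1 < 0 by omega), smul_smul, ← zpow_add₀ hq,
      neg_add_cancel, zpow_zero, one_smul, sub_add_cancel, Module.End.one_apply]
  · simp only [Module.End.mul_apply, LinearMap.smul_apply, LinearMap.add_apply, shift_e,
      opWo_e_of_pos _ _ _ _ _ hn, map_smul, map_add, map_sub, map_neg,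
      opW_e_of_nonneg _ _ _ _ _ (show 0 ≤ n - 1 by omega), sub_add_cancel,
      Module.End.one_apply, zpow_add₀ hq, zpow_neg, zpow_one]
    match_scalars <;> field_simp

lemma opWo_mul_opW (hq : q ≠ 0) (hz : w * q = -z) :
    opWo q z w μ * opW q z w μ = -(w • shift 1) - z • shift (-1) + μ • 1 := by
  obtain rfl : z = -(w * q) := by rw [hz, neg_neg]
  refine end_ext fun k n => ?_
  rcases le_or_gt 0 n with hn | hn
  · simp only [Module.End.mul_apply, LinearMap.smul_apply, LinearMap.add_apply,
      LinearMap.sub_apply, LinearMap.neg_apply, shift_e,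
      opW_e_of_nonneg _ _ _ _ _ hn, map_smul,
      opWo_e_of_pos _ _ _ _ _ (show 0 < n + 1 by omega), smul_smul, ← zpow_add₀ hq,
      add_neg_cancel, zpow_zero, one_smul, add_sub_cancel_right, Module.End.one_apply]
  · simp only [Module.End.mul_apply, LinearMap.smul_apply, LinearMap.add_apply,
      LinearMap.sub_apply, LinearMap.neg_apply, shift_e,
      opW_e_of_neg _ _ _ _ _ hn, map_smul, map_add,
      opWo_e_of_nonpos _ _ _ _ _ (show n + 1 ≤ 0 by omega), add_sub_cancel_right,
      Module.End.one_apply, neg_add, neg_neg, zpow_add₀ hq, zpow_neg, zpow_one]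
    match_scalars <;> field_simp

lemma opW_pow_e (z w : ℂ) (n : ℕ) : (opW q z w μ ^ n) (e 0 0) = e 0 n := by
  induction n with
  | zero => simp
  | succ n ih =>
    rw [pow_succ', Module.End.mul_apply, ih, opW_e_of_nonneg _ _ _ _ _ (Int.natCast_nonneg n)]
    simp

lemma opWo_pow_e (z w : ℂ) (n : ℕ) : (opWo q z w μ ^ n) (e 0 0) = e 0 (-n) := by
  induction n with
  | zero => simp
  | succ n ih =>
    rw [pow_succ', Module.End.mul_apply, ih, opWo_e_of_nonpos _ _ _ _ _ (by omega)]
    simp [sub_eq_add_neg, add_comm]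

lemma shift_pow_e (d : ℤ) (m : ℕ) (k n : ℤ) : (shift d ^ m) (e k n) = e (k + m * d) n := by
  induction m with
  | zero => simp
  | succ m ih =>
    rw [pow_succ', Module.End.mul_apply, ih, shift_e]
    push_cast
    ring_nf

end TorusModel

lemma qc_ne_zero (θ : ℝ) : qc θ ≠ 0 := Complex.exp_ne_zero _

lemma conj_qc (θ : ℝ) : (starRingEnd ℂ) (qc θ) = (qc θ)⁻¹ := by
  rw [qc, ← Complex.exp_conj, ← Complex.exp_neg]
  simp only [map_mul, map_ofNat, Complex.conj_ofReal, Complex.conj_I, mul_neg]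

lemma conj_zc_mul_qc (θ : ℝ) : (starRingEnd ℂ) (zc θ) * qc θ = -zc θ := by
  have h : Complex.exp (2 * Real.pi * θ * Complex.I) =
      Complex.exp (Real.pi * θ * Complex.I) * Complex.exp (Real.pi * θ * Complex.I) := by
    rw [← Complex.exp_add]
    ring_nf
  have h' : Complex.exp (-(Real.pi * θ * Complex.I)) * Complex.exp (Real.pi * θ * Complex.I) = 1 := by
    rw [← Complex.exp_add]
    simp
  rw [zc, qc, map_div₀, ← Complex.exp_conj, h]
  simp only [map_mul, Complex.conj_I, Complex.conj_ofReal, mul_neg, neg_mul, div_neg, map_ofNat]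
  rw [div_mul_eq_mul_div, ← mul_assoc, h', one_mul]

open TorusModel in
/-- The action of the free algebra on `TorusModel`. -/
def freeAction (θ μ : ℝ) : FreeFour →ₐ[ℂ] Module.End ℂ TorusModel :=
  FreeAlgebra.lift ℂ ![opW (qc θ) (zc θ) (starRingEnd ℂ (zc θ)) μ,
    opWo (qc θ) (zc θ) (starRingEnd ℂ (zc θ)) μ, shift 1, shift (-1)]

open TorusModel in
lemma freeAction_generators (θ μ : ℝ) :
    freeAction θ μ Wg = opW (qc θ) (zc θ) (starRingEnd ℂ (zc θ)) μ ∧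
    freeAction θ μ Wog = opWo (qc θ) (zc θ) (starRingEnd ℂ (zc θ)) μ ∧
    freeAction θ μ Lg = shift 1 ∧ freeAction θ μ Log = shift (-1) := by
  refine ⟨?_, ?_, ?_, ?_⟩ <;>
    simp [freeAction, Wg, Wog, Lg, Log, FreeAlgebra.lift_ι_apply]

open TorusModel in
lemma freeAction_rel (θ μ : ℝ) ⦃x y : FreeFour⦄ (h : TorusRel θ μ x y) :
    freeAction θ μ x = freeAction θ μ y := by
  obtain ⟨hW, hWo, hL, hLo⟩ := freeAction_generators θ μ
  have hq := qc_ne_zero θ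
  cases h <;>
    simp only [map_mul, map_add, map_sub, map_neg, map_smul, map_one, hW, hWo, hL, hLo]
  case rel1 => rw [opW_mul_shift _ _ _ hq, zpow_one]
  case rel2 => rw [opW_mul_shift _ _ _ hq, zpow_neg_one, conj_qc]
  case rel3 => rw [opWo_mul_shift _ _ _ hq, neg_neg, zpow_one]
  case rel4 => rw [opWo_mul_shift _ _ _ hq, zpow_neg_one, conj_qc]
  case rel5 => rw [shift_mul_shift, neg_add_cancel, shift_zero]
  case rel6 => rw [shift_mul_shift, add_neg_cancel, shift_zero]
  case rel7 => exact opW_mul_opWo _ hq (conj_zc_mul_qc θ)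
  case rel8 => exact opWo_mul_opW _ hq (conj_zc_mul_qc θ)

/-- The action of the deformed torus algebra on `TorusModel`. -/
def torusAction (θ μ : ℝ) : DefTorus θ μ →ₐ[ℂ] Module.End ℂ TorusModel :=
  RingQuot.liftAlgHom ℂ ⟨freeAction θ μ, freeAction_rel θ μ⟩

open TorusModel in
lemma torusAction_generators (θ μ : ℝ) :
    torusAction θ μ (Wq θ μ) = opW (qc θ) (zc θ) (starRingEnd ℂ (zc θ)) μ ∧
    torusAction θ μ (Woq θ μ) = opWo (qc θ) (zc θ) (starRingEnd ℂ (zc θ)) μ ∧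
    torusAction θ μ (Lq θ μ) = shift 1 ∧ torusAction θ μ (Loq θ μ) = shift (-1) := by
  simpa only [torusAction, Wq, Woq, Lq, Loq, RingQuot.liftAlgHom_mkAlgHom_apply]
    using freeAction_generators θ μ

open TorusModel in
lemma torusAction_lpow_e (θ μ : ℝ) (m k n : ℤ) :
    torusAction θ μ (lpow θ μ m) (e k n) = e (k + m) n := by
  obtain ⟨-, -, hL, hLo⟩ := torusAction_generators θ μ
  rw [lpow]
  split_ifs with hm
  · rw [map_pow, hL, shift_pow_e, Int.toNat_of_nonneg hm, mul_one]
  · rw [map_pow, hLo, shift_pow_e, Int.toNat_of_nonneg (by omega)]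
    simp

/-- The exponents `(k, n)` of the monomial `Λ^k W^n` or `Λ^k (W°)^{-n}` at an index of
`torusFam`. -/
def torusExponent : (ℤ × ℕ) ⊕ (ℤ × ℕ) → ℤ × ℤ
  | .inl m => (m.1, m.2)
  | .inr n => (n.1, -(n.2 + 1 : ℕ))

lemma torusExponent_injective : Function.Injective torusExponent := by
  rintro (⟨a, b⟩ | ⟨a, b⟩) (⟨c, d⟩ | ⟨c, d⟩) h <;>
    simp only [torusExponent, Prod.mk.injEq] at h <;>
    obtain ⟨rfl, h⟩ := h
  · obtain rfl : b = d := by omega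
    rfl
  · omega
  · omega
  · obtain rfl : b = d := by omega
    rfl

/-- The phase factor of `torusFam` at an index. -/
def torusPhase (θ : ℝ) : (ℤ × ℕ) ⊕ (ℤ × ℕ) → ℂ
  | .inl m => Complex.exp (Real.pi * θ * ((m.1 * m.2 : ℤ) : ℂ) * Complex.I)
  | .inr n => Complex.exp (-(Real.pi * θ * ((n.1 * (n.2 + 1) : ℤ) : ℂ) * Complex.I))

lemma torusPhase_ne_zero (θ : ℝ) (i : (ℤ × ℕ) ⊕ (ℤ × ℕ)) : torusPhase θ i ≠ 0 := by
  rcases i with i | i <;> exact Complex.exp_ne_zero _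

open TorusModel in
lemma torusAction_torusFam (θ μ : ℝ) (i : (ℤ × ℕ) ⊕ (ℤ × ℕ)) :
    torusAction θ μ (torusFam θ μ i) (e 0 0) =
      torusPhase θ i • Finsupp.single (torusExponent i) 1 := by
  obtain ⟨hW, hWo, -, -⟩ := torusAction_generators θ μ
  rcases i with ⟨m, n⟩ | ⟨m, n⟩
  · rw [torusFam, map_smul, LinearMap.smul_apply, map_mul, Module.End.mul_apply, map_pow, hW,
      opW_pow_e, torusAction_lpow_e, zero_add]
    rfl
  · rw [torusFam, map_smul, LinearMap.smul_apply, map_mul, Module.End.mul_apply, map_pow, hWo,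
      opWo_pow_e, torusAction_lpow_e, zero_add]
    rfl

lemma linearIndependent_torusFam (θ μ : ℝ) : LinearIndependent ℂ (torusFam θ μ) := by
  refine LinearIndependent.of_comp
    ((LinearMap.applyₗ (TorusModel.e 0 0)).comp (torusAction θ μ).toLinearMap) ?_
  have h := ((Finsupp.linearIndependent_single_one ℂ (ℤ × ℤ)).comp _
    torusExponent_injective).units_smul fun i => Units.mk0 _ (torusPhase_ne_zero θ i)
  convert h using 1
  exact funext (torusAction_torusFam θ μ)

section Relations

variable (θ μ : ℝ)

lemma Wq_mul_Lq : Wq θ μ * Lq θ μ = qc θ • (Lq θ μ * Wq θ μ) := by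
  simpa [Wq, Lq] using RingQuot.mkAlgHom_rel ℂ (TorusRel.rel1 (θ := θ) (μ := μ))

lemma Wq_mul_Loq : Wq θ μ * Loq θ μ = (qc θ)⁻¹ • (Loq θ μ * Wq θ μ) := by
  simpa [Wq, Loq, conj_qc] using RingQuot.mkAlgHom_rel ℂ (TorusRel.rel2 (θ := θ) (μ := μ))

lemma Woq_mul_Loq : Woq θ μ * Loq θ μ = qc θ • (Loq θ μ * Woq θ μ) := by
  simpa [Woq, Loq] using RingQuot.mkAlgHom_rel ℂ (TorusRel.rel3 (θ := θ) (μ := μ))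

lemma Woq_mul_Lq : Woq θ μ * Lq θ μ = (qc θ)⁻¹ • (Lq θ μ * Woq θ μ) := by
  simpa [Woq, Lq, conj_qc] using RingQuot.mkAlgHom_rel ℂ (TorusRel.rel4 (θ := θ) (μ := μ))

lemma Lq_mul_Loq : Lq θ μ * Loq θ μ = 1 := by
  simpa [Lq, Loq] using RingQuot.mkAlgHom_rel ℂ (TorusRel.rel5 (θ := θ) (μ := μ))

lemma Loq_mul_Lq : Loq θ μ * Lq θ μ = 1 := by
  simpa [Lq, Loq] using RingQuot.mkAlgHom_rel ℂ (TorusRel.rel6 (θ := θ) (μ := μ))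

lemma Wq_mul_Woq : Wq θ μ * Woq θ μ =
    zc θ • Lq θ μ + (starRingEnd ℂ (zc θ)) • Loq θ μ + (μ : ℂ) • 1 := by
  simpa only [Wq, Woq, Lq, Loq, map_mul, map_add, map_smul, map_one]
    using RingQuot.mkAlgHom_rel ℂ (TorusRel.rel7 (θ := θ) (μ := μ))

lemma Woq_mul_Wq : Woq θ μ * Wq θ μ =
    (-(starRingEnd ℂ (zc θ))) • Lq θ μ + (-zc θ) • Loq θ μ + (μ : ℂ) • 1 := by
  have h := RingQuot.mkAlgHom_rel ℂ (TorusRel.rel8 (θ := θ) (μ := μ))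
  rw [sub_eq_add_neg, ← neg_smul, ← neg_smul] at h
  simpa only [Wq, Woq, Lq, Loq, map_mul, map_add, map_smul, map_one] using h

/-- `Λ` as a unit. -/
def Lunit : (DefTorus θ μ)ˣ := ⟨Lq θ μ, Loq θ μ, Lq_mul_Loq θ μ, Loq_mul_Lq θ μ⟩

lemma lpow_eq (k : ℤ) : lpow θ μ k = ((Lunit θ μ ^ k : (DefTorus θ μ)ˣ) : DefTorus θ μ) := by
  rw [lpow]
  split_ifs with hk
  · obtain ⟨n, rfl⟩ := Int.eq_ofNat_of_zero_le hk
    simp [Lunit]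
  · obtain ⟨n, hn⟩ := Int.eq_ofNat_of_zero_le (show 0 ≤ -k by omega)
    obtain rfl : k = -n := by omega
    rw [neg_neg, zpow_neg, zpow_natCast, ← inv_pow, Units.val_pow_eq_pow_val]
    rfl

lemma lpow_zero : lpow θ μ 0 = 1 := by simp [lpow]

lemma Lq_mul_lpow (k : ℤ) : Lq θ μ * lpow θ μ k = lpow θ μ (k + 1) := by
  rw [lpow_eq, lpow_eq, add_comm, zpow_one_add, Units.val_mul]
  rfl

lemma lpow_mul_Lq (k : ℤ) : lpow θ μ k * Lq θ μ = lpow θ μ (k + 1) := by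
  rw [lpow_eq, lpow_eq, zpow_add_one, Units.val_mul]
  rfl

lemma Loq_mul_lpow (k : ℤ) : Loq θ μ * lpow θ μ k = lpow θ μ (k - 1) := by
  rw [← sub_add_cancel k 1, ← Lq_mul_lpow, ← mul_assoc, Loq_mul_Lq, one_mul, sub_add_cancel]

lemma lpow_mul_Loq (k : ℤ) : lpow θ μ k * Loq θ μ = lpow θ μ (k - 1) := by
  rw [← sub_add_cancel k 1, ← lpow_mul_Lq, mul_assoc, Lq_mul_Loq, mul_one, sub_add_cancel]

variable {θ μ}

lemma mul_lpow_of_mul {x : DefTorus θ μ} {c : ℂ} (hc : c ≠ 0)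
    (hL : x * Lq θ μ = c • (Lq θ μ * x)) (hLo : x * Loq θ μ = c⁻¹ • (Loq θ μ * x)) (k : ℤ) :
    x * lpow θ μ k = c ^ k • (lpow θ μ k * x) := by
  induction k with
  | zero => simp [lpow_zero]
  | succ n ih =>
    rw [← lpow_mul_Lq, ← mul_assoc, ih, smul_mul_assoc, mul_assoc, hL, mul_smul_comm, smul_smul,
      zpow_add_one₀ hc, mul_assoc]
  | pred n ih =>
    rw [← lpow_mul_Loq, ← mul_assoc, ih, smul_mul_assoc, mul_assoc, hLo, mul_smul_comm, smul_smul,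
      zpow_sub_one₀ hc, mul_assoc]

lemma Wq_mul_lpow (k : ℤ) : Wq θ μ * lpow θ μ k = qc θ ^ k • (lpow θ μ k * Wq θ μ) :=
  mul_lpow_of_mul (qc_ne_zero θ) (Wq_mul_Lq θ μ) (Wq_mul_Loq θ μ) k

lemma Woq_mul_lpow (k : ℤ) : Woq θ μ * lpow θ μ k = (qc θ)⁻¹ ^ k • (lpow θ μ k * Woq θ μ) :=
  mul_lpow_of_mul (inv_ne_zero (qc_ne_zero θ)) (Woq_mul_Lq θ μ)
    (by rw [inv_inv, Woq_mul_Loq]) k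

end Relations

/-- The span of the family `T_m`, `S_n`. -/
abbrev torusSpan (θ μ : ℝ) : Submodule ℂ (DefTorus θ μ) :=
  Submodule.span ℂ (Set.range (torusFam θ μ))

section Span

variable (θ μ : ℝ)

lemma lpow_mul_Wq_pow_mem (k : ℤ) (n : ℕ) : lpow θ μ k * Wq θ μ ^ n ∈ torusSpan θ μ :=
  ((torusSpan θ μ).smul_mem_iff (torusPhase_ne_zero θ (.inl (k, n)))).1
    (Submodule.subset_span ⟨.inl (k, n), rfl⟩)

lemma lpow_mul_Woq_pow_mem (k : ℤ) (n : ℕ) : lpow θ μ k * Woq θ μ ^ n ∈ torusSpan θ μ := by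
  cases n with
  | zero => simpa using lpow_mul_Wq_pow_mem θ μ k 0
  | succ n =>
    exact ((torusSpan θ μ).smul_mem_iff (torusPhase_ne_zero θ (.inr (k, n)))).1
      (Submodule.subset_span ⟨.inr (k, n), rfl⟩)

variable {θ μ}

lemma mul_mem_torusSpan {x : DefTorus θ μ}
    (hW : ∀ k n, x * (lpow θ μ k * Wq θ μ ^ n) ∈ torusSpan θ μ)
    (hWo : ∀ k n, x * (lpow θ μ k * Woq θ μ ^ (n + 1)) ∈ torusSpan θ μ)
    {y : DefTorus θ μ} (hy : y ∈ torusSpan θ μ) : x * y ∈ torusSpan θ μ := by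
  suffices h : torusSpan θ μ ≤ (torusSpan θ μ).comap (LinearMap.mulLeft ℂ x) from h hy
  rw [Submodule.span_le]
  rintro _ ⟨⟨k, n⟩ | ⟨k, n⟩, rfl⟩
  · simpa only [torusFam, SetLike.mem_coe, Submodule.mem_comap, LinearMap.mulLeft_apply,
      mul_smul_comm] using Submodule.smul_mem _ _ (hW k n)
  · simpa only [torusFam, SetLike.mem_coe, Submodule.mem_comap, LinearMap.mulLeft_apply,
      mul_smul_comm] using Submodule.smul_mem _ _ (hWo k n)

lemma Lq_mul_mem {y : DefTorus θ μ} (hy : y ∈ torusSpan θ μ) : Lq θ μ * y ∈ torusSpan θ μ := by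
  refine mul_mem_torusSpan (fun k n => ?_) (fun k n => ?_) hy <;> rw [← mul_assoc, Lq_mul_lpow]
  · exact lpow_mul_Wq_pow_mem θ μ _ _
  · exact lpow_mul_Woq_pow_mem θ μ _ _

lemma Loq_mul_mem {y : DefTorus θ μ} (hy : y ∈ torusSpan θ μ) : Loq θ μ * y ∈ torusSpan θ μ := by
  refine mul_mem_torusSpan (fun k n => ?_) (fun k n => ?_) hy <;> rw [← mul_assoc, Loq_mul_lpow]
  · exact lpow_mul_Wq_pow_mem θ μ _ _
  · exact lpow_mul_Woq_pow_mem θ μ _ _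

lemma Wq_mul_mem {y : DefTorus θ μ} (hy : y ∈ torusSpan θ μ) : Wq θ μ * y ∈ torusSpan θ μ := by
  refine mul_mem_torusSpan (fun k n => ?_) (fun k n => ?_) hy <;>
    rw [← mul_assoc, Wq_mul_lpow, smul_mul_assoc] <;>
    refine Submodule.smul_mem _ _ ?_
  · rw [mul_assoc, ← pow_succ']
    exact lpow_mul_Wq_pow_mem θ μ _ _
  · rw [pow_succ', ← mul_assoc, mul_assoc (lpow θ μ k), Wq_mul_Woq]
    simp only [mul_add, add_mul, mul_smul_comm, smul_mul_assoc, lpow_mul_Lq, lpow_mul_Loq, mul_one]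
    have h := fun j => lpow_mul_Woq_pow_mem θ μ j n
    exact add_mem (add_mem (Submodule.smul_mem _ _ (h _)) (Submodule.smul_mem _ _ (h _)))
      (Submodule.smul_mem _ _ (h _))

lemma Woq_mul_mem {y : DefTorus θ μ} (hy : y ∈ torusSpan θ μ) : Woq θ μ * y ∈ torusSpan θ μ := by
  have hWo : ∀ k n, Woq θ μ * (lpow θ μ k * Woq θ μ ^ n) ∈ torusSpan θ μ := fun k n => by
    rw [← mul_assoc, Woq_mul_lpow, smul_mul_assoc, mul_assoc, ← pow_succ']
    exact Submodule.smul_mem _ _ (lpow_mul_Woq_pow_mem θ μ _ _)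
  refine mul_mem_torusSpan (fun k n => ?_) (fun k n => hWo k (n + 1)) hy
  cases n with
  | zero => simpa using hWo k 0
  | succ n =>
    rw [← mul_assoc, Woq_mul_lpow, smul_mul_assoc, pow_succ', ← mul_assoc,
      mul_assoc (lpow θ μ k), Woq_mul_Wq]
    refine Submodule.smul_mem _ _ ?_
    simp only [mul_add, add_mul, mul_smul_comm, smul_mul_assoc, lpow_mul_Lq, lpow_mul_Loq, mul_one]
    have h := fun j => lpow_mul_Wq_pow_mem θ μ j n
    exact add_mem (add_mem (Submodule.smul_mem _ _ (h _)) (Submodule.smul_mem _ _ (h _)))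
      (Submodule.smul_mem _ _ (h _))

lemma mkAlgHom_mul_mem (a : FreeFour) :
    ∀ y ∈ torusSpan θ μ, RingQuot.mkAlgHom ℂ (TorusRel θ μ) a * y ∈ torusSpan θ μ := by
  induction a using FreeAlgebra.induction with
  | grade0 r =>
    intro y hy
    rw [AlgHom.commutes, ← Algebra.smul_def]
    exact Submodule.smul_mem _ _ hy
  | grade1 i =>
    intro y hy
    fin_cases i
    · exact Wq_mul_mem hy
    · exact Woq_mul_mem hy
    · exact Lq_mul_mem hy
    · exact Loq_mul_mem hy
  | mul a b ha hb =>
    intro y hy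
    rw [map_mul, mul_assoc]
    exact ha _ (hb _ hy)
  | add a b ha hb =>
    intro y hy
    rw [map_add, add_mul]
    exact add_mem (ha _ hy) (hb _ hy)

lemma torusSpan_eq_top (θ μ : ℝ) : torusSpan θ μ = ⊤ := by
  refine Submodule.eq_top_iff'.2 fun x => ?_
  obtain ⟨a, rfl⟩ := RingQuot.mkAlgHom_surjective ℂ (TorusRel θ μ) x
  have h1 : (1 : DefTorus θ μ) ∈ torusSpan θ μ := by
    simpa [lpow_zero] using lpow_mul_Wq_pow_mem θ μ 0 0
  simpa using mkAlgHom_mul_mem a 1 h1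

end Span

/-- If `μ > 0` and `|μ cos(πθ)| > 1`, the family `T_m`, `S_n` is a
basis of the deformed torus algebra `A⁰_{μ,θ}` as a ℂ-vector space. -/
theorem stmt5 (θ μ : ℝ) (hμ : 0 < μ) (hμθ : 1 < |μ * Real.cos (Real.pi * θ)|) :
    LinearIndependent ℂ (torusFam θ μ) ∧
    Submodule.span ℂ (Set.range (torusFam θ μ)) = ⊤ := by
  exact ⟨linearIndependent_torusFam θ μ, torusSpan_eq_top θ μ⟩

end
end

section
/- Let A be a unital associative ℂ-algebra, ℏ, μ ∈ ℝ, and suppose X, Y, Z ∈ A satisfy [X,Y] = iℏZ, [Y,Z] = iℏ(2X³ + XY² + Y²X − 2μX), and [Z,X] = iℏ(2Y³ + YX² + X²Y − 2μY). Then the element Ĉ = (X² + Y² − μ·1)² + Z² is central among the generators: [X, Ĉ] = [Y, Ĉ] = [Z, Ĉ] = 0. -/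
open Complex

/-- In a unital associative ℂ-algebra, if `X, Y, Z` satisfy the
defining relations of the deformed algebra `C_{ℏ,μ}`, then
`Ĉ = (X² + Y² − μ·1)² + Z²` commutes with `X`, `Y` and `Z`. -/
theorem stmt7 {A : Type*} [Ring A] [Algebra ℂ A] (ℏ μ : ℝ) (X Y Z : A)
    (h1 : X * Y - Y * X = (Complex.I * (ℏ : ℂ)) • Z)
    (h2 : Y * Z - Z * Y = (Complex.I * (ℏ : ℂ)) •
      ((2 : ℂ) • X ^ 3 + X * Y ^ 2 + Y ^ 2 * X - (2 * (μ : ℂ)) • X))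
    (h3 : Z * X - X * Z = (Complex.I * (ℏ : ℂ)) •
      ((2 : ℂ) • Y ^ 3 + Y * X ^ 2 + X ^ 2 * Y - (2 * (μ : ℂ)) • Y)) :
    let C : A := (X ^ 2 + Y ^ 2 - (μ : ℂ) • 1) ^ 2 + Z ^ 2
    X * C - C * X = 0 ∧ Y * C - C * Y = 0 ∧ Z * C - C * Z = 0 := by
  intro C
  have hc : (1 : ℂ) - (I * ℏ) * (I * ℏ) ≠ 0 := by
    have h : (1 : ℂ) - (I * ℏ) * (I * ℏ) = ((1 + ℏ ^ 2 : ℝ) : ℂ) := by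
      push_cast
      linear_combination (-(ℏ : ℂ) ^ 2) * I_sq
    rw [h, ofReal_ne_zero]
    positivity
  generalize I * (ℏ : ℂ) = c at *
  obtain ⟨D, hD⟩ : ∃ D : A, D = X ^ 2 + Y ^ 2 - (μ : ℂ) • 1 := ⟨_, rfl⟩
  have hC : C = D ^ 2 + Z ^ 2 := by rw [hD]
  have hS : Y * Z - Z * Y = c • (X * D + D * X) := by
    rw [h2, hD]
    congr 1
    simp only [mul_add, add_mul, mul_sub, sub_mul, smul_mul_assoc, mul_smul_comm, mul_one,
      one_mul, pow_succ, pow_zero, mul_assoc]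
    module
  have hR : Z * X - X * Z = c • (Y * D + D * Y) := by
    rw [h3, hD]
    congr 1
    simp only [mul_add, add_mul, mul_sub, sub_mul, smul_mul_assoc, mul_smul_comm, mul_one,
      one_mul, pow_succ, pow_zero, mul_assoc]
    module
  have hXD : X * D - D * X = (X * Y - Y * X) * Y + Y * (X * Y - Y * X) := by
    rw [hD]
    simp only [mul_add, add_mul, mul_sub, sub_mul, smul_mul_assoc, mul_smul_comm, mul_one,
      one_mul, pow_succ, pow_zero, mul_assoc]
    abel
  have hYD : Y * D - D * Y = -((X * Y - Y * X) * X + X * (X * Y - Y * X)) := by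
    rw [hD]
    simp only [mul_add, add_mul, mul_sub, sub_mul, smul_mul_assoc, mul_smul_comm, mul_one,
      one_mul, pow_succ, pow_zero, mul_assoc]
    abel
  have hZD : Z * D - D * Z = (Z * X - X * Z) * X + X * (Z * X - X * Z)
      - ((Y * Z - Z * Y) * Y + Y * (Y * Z - Z * Y)) := by
    rw [hD]
    simp only [mul_add, add_mul, mul_sub, sub_mul, smul_mul_assoc, mul_smul_comm, mul_one,
      one_mul, pow_succ, pow_zero, mul_assoc]
    abel
  have hcomm : Z * D = D * Z := by
    have h : Z * D - D * Z = c • ((X * Y - Y * X) * D - D * (X * Y - Y * X)) := by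
      rw [hZD, hR, hS]
      simp only [mul_add, add_mul, mul_sub, sub_mul, smul_mul_assoc, mul_smul_comm, mul_assoc]
      module
    rw [h1, smul_mul_assoc, mul_smul_comm, ← smul_sub, smul_smul] at h
    have h' : (1 - c * c) • (Z * D - D * Z) = 0 := by
      rw [sub_smul, one_smul, ← h, sub_self]
    exact sub_eq_zero.mp ((smul_eq_zero_iff_right hc).mp h')
  clear_value C
  subst hC
  rw [h1] at hXD hYD
  refine ⟨?_, ?_, ?_⟩
  · calc X * (D ^ 2 + Z ^ 2) - (D ^ 2 + Z ^ 2) * X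
        = (X * D - D * X) * D + D * (X * D - D * X)
          - ((Z * X - X * Z) * Z + Z * (Z * X - X * Z)) := by noncomm_ring
      _ = c • (Y * (Z * D - D * Z) - (Z * D - D * Z) * Y) := by
        rw [hXD, hR]
        simp only [mul_add, add_mul, mul_sub, sub_mul, smul_mul_assoc, mul_smul_comm, mul_assoc]
        module
      _ = 0 := by simp [hcomm]
  · calc Y * (D ^ 2 + Z ^ 2) - (D ^ 2 + Z ^ 2) * Y
        = (Y * D - D * Y) * D + D * (Y * D - D * Y)
          + ((Y * Z - Z * Y) * Z + Z * (Y * Z - Z * Y)) := by noncomm_ring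
      _ = c • ((Z * D - D * Z) * X - X * (Z * D - D * Z)) := by
        rw [hYD, hS]
        simp only [mul_add, add_mul, mul_sub, sub_mul, mul_neg, neg_mul, smul_mul_assoc,
          mul_smul_comm, mul_assoc]
        module
      _ = 0 := by simp [hcomm]
  · calc Z * (D ^ 2 + Z ^ 2) - (D ^ 2 + Z ^ 2) * Z
        = (Z * D - D * Z) * D + D * (Z * D - D * Z) := by noncomm_ring
      _ = 0 := by simp [hcomm]
end

section
/- Let A be a unital associative ℂ-algebra, ℏ, μ ∈ ℝ, and suppose X, Y, Z ∈ A satisfy [X,Y] = iℏZ, [Y,Z] = iℏ(2X³ + XY² + Y²X − 2μX), and [Z,X] = iℏ(2Y³ + YX² + X²Y − 2μY). Then Z commutes with X² + Y²: [Z, X² + Y²] = 0. -/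
open Complex

/-- In a unital associative ℂ-algebra, if `X, Y, Z` satisfy the
defining relations of the deformed algebra `C_{ℏ,μ}`, then `Z` commutes with
`X² + Y²`. -/
theorem stmt8 {A : Type*} [Ring A] [Algebra ℂ A] (ℏ μ : ℝ) (X Y Z : A)
    (h1 : X * Y - Y * X = (Complex.I * (ℏ : ℂ)) • Z)
    (h2 : Y * Z - Z * Y = (Complex.I * (ℏ : ℂ)) •
      ((2 : ℂ) • X ^ 3 + X * Y ^ 2 + Y ^ 2 * X - (2 * (μ : ℂ)) • X))
    (h3 : Z * X - X * Z = (Complex.I * (ℏ : ℂ)) •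
      ((2 : ℂ) • Y ^ 3 + Y * X ^ 2 + X ^ 2 * Y - (2 * (μ : ℂ)) • Y)) :
    Z * (X ^ 2 + Y ^ 2) - (X ^ 2 + Y ^ 2) * Z = 0 := by
  have key : Z * (X ^ 2 + Y ^ 2) - (X ^ 2 + Y ^ 2) * Z =
      (Complex.I * (ℏ : ℂ)) •
        ((X * Y - Y * X) * (X ^ 2 + Y ^ 2) - (X ^ 2 + Y ^ 2) * (X * Y - Y * X)) := by
    have expand : Z * (X ^ 2 + Y ^ 2) - (X ^ 2 + Y ^ 2) * Z =
        (Z * X - X * Z) * X + X * (Z * X - X * Z)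
          - ((Y * Z - Z * Y) * Y + Y * (Y * Z - Z * Y)) := by
      noncomm_ring
    rw [expand, h2, h3]
    simp only [pow_succ, pow_zero, one_mul, mul_add, add_mul, mul_sub, sub_mul,
      smul_mul_assoc, mul_smul_comm, mul_assoc]
    module
  rw [h1, smul_mul_assoc, mul_smul_comm, ← smul_sub, smul_smul] at key
  have hc : (1 : ℂ) - Complex.I * (ℏ : ℂ) * (Complex.I * (ℏ : ℂ)) ≠ 0 := by
    have h : (1 : ℂ) - Complex.I * (ℏ : ℂ) * (Complex.I * (ℏ : ℂ)) =
        ((1 + ℏ ^ 2 : ℝ) : ℂ) := by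
      push_cast
      linear_combination -(ℏ : ℂ) ^ 2 * Complex.I_sq
    rw [h]
    exact Complex.ofReal_ne_zero.mpr (by positivity)
  refine (smul_eq_zero_iff_right hc).mp ?_
  rw [sub_smul, one_smul, ← key, sub_self]
end

section
/- Let A be a unital associative ℂ-algebra, ℏ, μ ∈ ℝ, and suppose X, Y, Z ∈ A satisfy [X,Y] = iℏZ, [Y,Z] = iℏ(2X³ + XY² + Y²X − 2μX), and [Z,X] = iℏ(2Y³ + YX² + X²Y − 2μY). Set W = X + iY and W° = X − iY. Then (W²W° + W°W²)(1 + ℏ²) = 4μℏ²W + 2(1 − ℏ²)WW°W. -/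
open Complex

/-- In a unital associative ℂ-algebra, if `X, Y, Z` satisfy the
defining relations of the deformed algebra `C_{ℏ,μ}`, and `W = X + iY`,
`W° = X − iY`, then `(W²W° + W°W²)(1 + ℏ²) = 4μℏ²W + 2(1 − ℏ²)WW°W`. -/
theorem stmt9 {A : Type*} [Ring A] [Algebra ℂ A] (ℏ μ : ℝ) (X Y Z : A)
    (h1 : X * Y - Y * X = (Complex.I * (ℏ : ℂ)) • Z)
    (h2 : Y * Z - Z * Y = (Complex.I * (ℏ : ℂ)) •
      ((2 : ℂ) • X ^ 3 + X * Y ^ 2 + Y ^ 2 * X - (2 * (μ : ℂ)) • X))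
    (h3 : Z * X - X * Z = (Complex.I * (ℏ : ℂ)) •
      ((2 : ℂ) • Y ^ 3 + Y * X ^ 2 + X ^ 2 * Y - (2 * (μ : ℂ)) • Y)) :
    let W : A := X + Complex.I • Y
    let Wo : A := X - Complex.I • Y
    ((1 + ℏ ^ 2 : ℝ) : ℂ) • (W ^ 2 * Wo + Wo * W ^ 2) =
      ((4 * μ * ℏ ^ 2 : ℝ) : ℂ) • W + ((2 * (1 - ℏ ^ 2) : ℝ) : ℂ) • (W * Wo * W) := by
  intro W Wo
  have hI : Complex.I ^ 2 = -1 := Complex.I_sq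
  have hYD : Y * (X * Y - Y * X) - (X * Y - Y * X) * Y = (-(ℏ : ℂ) ^ 2) •
      ((2 : ℂ) • X ^ 3 + X * Y ^ 2 + Y ^ 2 * X - (2 * (μ : ℂ)) • X) := by
    rw [h1, mul_smul_comm, smul_mul_assoc, ← smul_sub, h2, smul_smul]
    congr 1
    linear_combination (ℏ : ℂ) ^ 2 * hI
  have hDX : (X * Y - Y * X) * X - X * (X * Y - Y * X) = (-(ℏ : ℂ) ^ 2) •
      ((2 : ℂ) • Y ^ 3 + Y * X ^ 2 + X ^ 2 * Y - (2 * (μ : ℂ)) • Y) := by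
    rw [h1, mul_smul_comm, smul_mul_assoc, ← smul_sub, h3, smul_smul]
    congr 1
    linear_combination (ℏ : ℂ) ^ 2 * hI
  simp only [pow_succ, pow_zero, one_mul, mul_add, add_mul, mul_sub, sub_mul, ← mul_assoc,
    smul_mul_assoc, mul_smul_comm, W, Wo] at hYD hDX ⊢
  push_cast
  rw [← sub_eq_zero] at hYD hDX ⊢
  have key := congrArg₂ (fun a b : A => (2 : ℂ) • a + (2 * Complex.I) • b) hYD hDX
  simp only [smul_zero, add_zero] at key
  rw [← key]
  match_scalars <;> grind
end

section
/- Let A be a unital associative ℂ-algebra, let θ, μ ∈ ℝ with cos(πθ) ≠ 0, and set ℏ = tan(πθ). Suppose X, Y, Z ∈ A satisfy [X,Y] = iℏZ, [Y,Z] = iℏ(2X³ + XY² + Y²X − 2μX), and [Z,X] = iℏ(2Y³ + YX² + X²Y − 2μY). Define W = X + iY and Λ = Z + i(X² + Y² − μ·1). Then WΛ = e^{2πiθ} Λ W. -/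
open Real Complex

/-- The commutation relations say that `W` and `Λ` have commutator `c` times their
anticommutator, where `c = iℏ`. -/
lemma commutator_eq_smul_anticommutator {A : Type*} [Ring A] [Algebra ℂ A] (c μ : ℂ) (X Y Z : A)
    (h1 : X * Y - Y * X = c • Z)
    (h2 : Y * Z - Z * Y =
      c • ((2 : ℂ) • X ^ 3 + X * Y ^ 2 + Y ^ 2 * X - (2 * μ) • X))
    (h3 : Z * X - X * Z =
      c • ((2 : ℂ) • Y ^ 3 + Y * X ^ 2 + X ^ 2 * Y - (2 * μ) • Y)) :
    let W : A := X + I • Y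
    let Λ : A := Z + I • (X ^ 2 + Y ^ 2 - μ • 1)
    W * Λ - Λ * W = c • (W * Λ + Λ * W) := by
  intro W Λ
  have hI : I * I = -1 := I_mul_I
  have hcomm : W * Λ - Λ * W = -(Z * X - X * Z) + I • (Y * Z - Z * Y)
      + I • ((X * Y - Y * X) * Y + Y * (X * Y - Y * X))
      + (X * (X * Y - Y * X) + (X * Y - Y * X) * X) := by
    simp only [W, Λ, mul_add, add_mul, mul_sub, sub_mul, smul_mul_assoc, mul_smul_comm, smul_add,
      smul_sub, smul_smul, hI, pow_two, mul_one, one_mul, mul_assoc]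
    module
  rw [hcomm, h1, h2, h3]
  have hI' (a : ℂ) : I * (I * a) = -a := by rw [← mul_assoc, hI, neg_one_mul]
  simp only [W, Λ, mul_add, add_mul, mul_sub, sub_mul, smul_mul_assoc, mul_smul_comm, smul_add,
    smul_sub, smul_smul, hI, hI', pow_succ, pow_zero, mul_one, one_mul, mul_assoc]
  match_scalars <;> first | ring1 | linear_combination c * μ * hI

/-- The Cayley transform of `i tan z` is `exp (2iz)`. -/
lemma one_sub_I_mul_tan_mul_exp {z : ℂ} (hz : Complex.cos z ≠ 0) :
    (1 - I * Complex.tan z) * Complex.exp (2 * z * I) = 1 + I * Complex.tan z := by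
  have hexp : Complex.exp (2 * z * I) = (Complex.cos z + Complex.sin z * I) ^ 2 := by
    rw [← Complex.exp_mul_I, ← Complex.exp_nat_mul]
    push_cast
    ring_nf
  rw [hexp, Complex.tan_eq_sin_div_cos]
  field_simp
  linear_combination (Complex.cos z + Complex.sin z * I) *
    (Complex.sin_sq_add_cos_sq z - Complex.sin z ^ 2 * I_sq)

/-- In a unital associative ℂ-algebra, with `ℏ = tan(πθ)`, if
`X, Y, Z` satisfy the defining relations of `C_{ℏ,μ}`, then `W = X + iY` and
`Λ = Z + i(X² + Y² − μ·1)` satisfy `WΛ = e^{2πiθ}ΛW`. -/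
theorem stmt12 {A : Type*} [Ring A] [Algebra ℂ A] (θ μ : ℝ)
    (hθ : Real.cos (Real.pi * θ) ≠ 0) (X Y Z : A)
    (h1 : X * Y - Y * X =
      (Complex.I * ((Real.tan (Real.pi * θ) : ℝ) : ℂ)) • Z)
    (h2 : Y * Z - Z * Y = (Complex.I * ((Real.tan (Real.pi * θ) : ℝ) : ℂ)) •
      ((2 : ℂ) • X ^ 3 + X * Y ^ 2 + Y ^ 2 * X - (2 * (μ : ℂ)) • X))
    (h3 : Z * X - X * Z = (Complex.I * ((Real.tan (Real.pi * θ) : ℝ) : ℂ)) •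
      ((2 : ℂ) • Y ^ 3 + Y * X ^ 2 + X ^ 2 * Y - (2 * (μ : ℂ)) • Y)) :
    let W : A := X + Complex.I • Y
    let Λ : A := Z + Complex.I • (X ^ 2 + Y ^ 2 - (μ : ℂ) • 1)
    W * Λ = Complex.exp (2 * Real.pi * θ * Complex.I) • (Λ * W) := by
  intro W Λ
  set c : ℂ := I * ((Real.tan (Real.pi * θ) : ℝ) : ℂ) with hc
  have hcos : Complex.cos ((Real.pi * θ : ℝ) : ℂ) ≠ 0 := by exact_mod_cast hθ
  have hq : (1 - c) * Complex.exp (2 * Real.pi * θ * I) = 1 + c := by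
    have h := one_sub_I_mul_tan_mul_exp hcos
    rw [← Complex.ofReal_tan, ← hc] at h
    rw [← h]
    push_cast
    ring_nf
  have hne : 1 - c ≠ 0 := by
    intro h0
    rw [h0, zero_mul] at hq
    exact two_ne_zero (α := ℂ) (by linear_combination h0 - hq)
  have hWΛ := commutator_eq_smul_anticommutator c μ X Y Z h1 h2 h3
  change W * Λ - Λ * W = c • (W * Λ + Λ * W) at hWΛ
  apply smul_right_injective A hne
  change (1 - c) • (W * Λ) = (1 - c) • _
  rw [smul_smul, hq]
  linear_combination (norm := module) hWΛ
end
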